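/- Let X_1, ..., X_n be independent Z/pZ-valued random variables such that each pmf f_i is either △-regular or □-regular and moreover equals its own rearrangement (f_i = f_i^*, f_i^+, or f_i^-). Then for any nonzero a_1, ..., a_n ∈ Z/pZ and any α ∈ [0, ∞], H_α(a_1 X_1 ⊕ ... ⊕ a_n X_n) ≥ H_α(X_1 ⊕ ... ⊕ X_n). -/

import Mathlib

open scoped BigOperators ENNReal Classical

namespace Paper

variable {p : ℕ}

/-- Convolution of two functions on `ZMod p`. -/
noncomputable def conv [NeZero p] (f g : ZMod p → ℝ) : ZMod p → ℝ :=
  fun k => ∑ i : ZMod p, f i * g (k - i)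

/-- Iterated convolution of a list of functions (the delta mass at `0` is the
convolution identity used as the base of the fold). -/
noncomputable def convList [NeZero p] (l : List (ZMod p → ℝ)) : ZMod p → ℝ :=
  l.foldr conv (fun k => if k = 0 then 1 else 0)

/-- The enumeration `0, +1, -1, +2, -2, ...` of `ZMod p`. -/
def plusSeq (p : ℕ) (n : ℕ) : ZMod p :=
  if n % 2 = 0 then -((n / 2 : ℕ) : ZMod p) else (((n + 1) / 2 : ℕ) : ZMod p)

/-- The enumeration `0, -1, +1, -2, +2, ...` of `ZMod p`. -/
def minusSeq (p : ℕ) (n : ℕ) : ZMod p := -(plusSeq p n)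

/-- `fp` is the `+`-rearrangement of `f`: a permutation of the values of `f` that is
nonincreasing along the ordering `0, +1, -1, +2, -2, ...`. -/
def IsPlusRearr (f fp : ZMod p → ℝ) : Prop :=
  (∃ σ : Equiv.Perm (ZMod p), fp = f ∘ σ) ∧
    ∀ n : ℕ, n + 1 < p → fp (plusSeq p (n + 1)) ≤ fp (plusSeq p n)

/-- `fm` is the `-`-rearrangement of `f`: a permutation of the values of `f` that is
nonincreasing along the ordering `0, -1, +1, -2, +2, ...`. -/
def IsMinusRearr (f fm : ZMod p → ℝ) : Prop :=
  (∃ σ : Equiv.Perm (ZMod p), fm = f ∘ σ) ∧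
    ∀ n : ℕ, n + 1 < p → fm (minusSeq p (n + 1)) ≤ fm (minusSeq p n)

/-- `f` is `△`-regular: its `+`-rearrangement is symmetric (so `f⁺ = f⁻`). -/
def TriangleRegular (f : ZMod p → ℝ) : Prop :=
  ∃ fp, IsPlusRearr f fp ∧ ∀ z, fp (-z) = fp z

/-- `f` is `□`-regular: `f⁺(z+1) = f⁻(z)` for all `z`. -/
def SquareRegular (f : ZMod p → ℝ) : Prop :=
  ∃ fp fm, IsPlusRearr f fp ∧ IsMinusRearr f fm ∧ ∀ z, fp (z + 1) = fm z

/-- probability mass function on `ZMod p`. -/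
def IsPMF [NeZero p] (f : ZMod p → ℝ) : Prop :=
  (∀ i, 0 ≤ f i) ∧ ∑ i : ZMod p, f i = 1

/-- Weak majorization: for every `r`, the sum of the `r` largest values of `f` is at most
the sum of the `r` largest values of `g` (expressed via subsets of each cardinality). -/
def WeakMaj [NeZero p] (f g : ZMod p → ℝ) : Prop :=
  ∀ s : Finset (ZMod p), ∃ t : Finset (ZMod p),
    t.card = s.card ∧ ∑ i ∈ s, f i ≤ ∑ i ∈ t, g i

/-- Majorization: weak majorization together with equality of total sums. -/
def Maj [NeZero p] (f g : ZMod p → ℝ) : Prop :=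
  WeakMaj f g ∧ ∑ i : ZMod p, f i = ∑ i : ZMod p, g i

/-- `f` and `g` are shape-equivalent: there is a single ordering of the index set along
which both are nonincreasing. -/
def ShapeEquiv [NeZero p] (f g : ZMod p → ℝ) : Prop :=
  ∃ e : Fin p ≃ ZMod p, (∀ m n : Fin p, m ≤ n → f (e n) ≤ f (e m)) ∧
    (∀ m n : Fin p, m ≤ n → g (e n) ≤ g (e m))

/-- Rényi entropy of order `α ∈ [0,∞]` of a pmf on `ZMod p`. -/
noncomputable def renyi [NeZero p] (α : ℝ≥0∞) (f : ZMod p → ℝ) : ℝ :=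
  if α = 0 then Real.log ((Finset.univ.filter (fun i => f i ≠ 0)).card)
  else if α = 1 then ∑ i : ZMod p, Real.negMulLog (f i)
  else if α = ⊤ then -Real.log (⨆ i : ZMod p, f i)
  else (1 - α.toReal)⁻¹ * Real.log (∑ i : ZMod p, f i ^ α.toReal)

/-- The indicator function of a finite set. -/
noncomputable def ind (A : Finset (ZMod p)) : ZMod p → ℝ := fun x => if x ∈ A then 1 else 0

lemma ind_nonneg (A : Finset (ZMod p)) (x : ZMod p) : 0 ≤ ind A x := by
  unfold ind; split_ifs <;> norm_num

lemma ind_add_of_disjoint {A B : Finset (ZMod p)} (h : Disjoint A B) :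
    ind (A ∪ B) = ind A + ind B := by
  funext x
  have hx : x ∈ A → x ∉ B := fun hA => Finset.disjoint_left.1 h hA
  simp only [ind, Pi.add_apply, Finset.mem_union]
  by_cases hA : x ∈ A <;> by_cases hB : x ∈ B <;> simp_all

section Convolution

variable [NeZero p]

lemma conv_comm (f g : ZMod p → ℝ) : conv f g = conv g f := by
  funext x
  refine Fintype.sum_equiv (Equiv.subLeft x) _ _ fun i => ?_
  simp [mul_comm]

lemma conv_add_left (f g h : ZMod p → ℝ) : conv (f + g) h = conv f h + conv g h := by
  funext x
  simp [conv, add_mul, Finset.sum_add_distrib]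

lemma conv_add_right (f g h : ZMod p → ℝ) : conv f (g + h) = conv f g + conv f h := by
  funext x
  simp [conv, mul_add, Finset.sum_add_distrib]

lemma conv_smul_left (c : ℝ) (f g : ZMod p → ℝ) : conv (c • f) g = c • conv f g := by
  funext x
  simp [conv, Finset.mul_sum, mul_assoc]

lemma conv_smul_right (c : ℝ) (f g : ZMod p → ℝ) : conv f (c • g) = c • conv f g := by
  rw [conv_comm, conv_smul_left, conv_comm]

lemma conv_translate (f g : ZMod p → ℝ) (a b : ZMod p) :
    conv (fun x => f (x - a)) (fun x => g (x - b)) = fun x => conv f g (x - (a + b)) := by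
  funext x
  refine Fintype.sum_equiv (Equiv.subRight a) _ _ fun i => ?_
  simp only [Equiv.subRight_apply]
  congr 2
  ring

lemma sum_conv_mul (f g h : ZMod p → ℝ) :
    ∑ x, conv f g x * h x = ∑ y, g y * ∑ z, f z * h (z + y) := by
  have h1 : ∀ z : ZMod p, ∑ x, f z * g (x - z) * h x = ∑ y, f z * g y * h (z + y) := fun z =>
    Fintype.sum_equiv (Equiv.subRight z) _ _ fun x => by simp
  simp only [conv, Finset.sum_mul, Finset.mul_sum]
  rw [Finset.sum_comm, Finset.sum_congr rfl fun z _ => h1 z, Finset.sum_comm]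
  exact Finset.sum_congr rfl fun y _ => Finset.sum_congr rfl fun z _ => by ring

lemma sum_conv (f g : ZMod p → ℝ) : ∑ x, conv f g x = (∑ x, f x) * ∑ x, g x := by
  have h := sum_conv_mul f g 1
  simp only [Pi.one_apply, mul_one] at h
  rw [h, ← Finset.sum_mul, mul_comm]

lemma conv_nonneg {f g : ZMod p → ℝ} (hf : ∀ x, 0 ≤ f x) (hg : ∀ x, 0 ≤ g x) (x : ZMod p) :
    0 ≤ conv f g x :=
  Finset.sum_nonneg fun _ _ => mul_nonneg (hf _) (hg _)

lemma sum_ind_mul (A : Finset (ZMod p)) (q : ZMod p → ℝ) : ∑ x, ind A x * q x = ∑ x ∈ A, q x := by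
  simp [ind]

lemma sum_ind (A : Finset (ZMod p)) : ∑ x, ind A x = A.card := by
  simp [ind]

lemma conv_ind_apply (A B : Finset (ZMod p)) (x : ZMod p) :
    conv (ind A) (ind B) x = ({y ∈ A | x - y ∈ B} : Finset (ZMod p)).card := by
  simp only [conv]
  rw [sum_ind_mul, Finset.card_filter]
  simp [ind]

lemma sum_conv_ind (A B : Finset (ZMod p)) :
    ∑ x, conv (ind A) (ind B) x = (A.card : ℝ) * B.card := by
  rw [sum_conv, sum_ind, sum_ind]

lemma conv_ind_le_card_left (A B : Finset (ZMod p)) (x : ZMod p) :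
    conv (ind A) (ind B) x ≤ A.card := by
  rw [conv_ind_apply]
  exact_mod_cast Finset.card_filter_le _ _

lemma conv_ind_le_card_right (A B : Finset (ZMod p)) (x : ZMod p) :
    conv (ind A) (ind B) x ≤ B.card := by
  rw [conv_comm]
  exact conv_ind_le_card_left B A x

lemma conv_ind_mono_right (A : Finset (ZMod p)) {B C : Finset (ZMod p)} (h : B ⊆ C) (x : ZMod p) :
    conv (ind A) (ind B) x ≤ conv (ind A) (ind C) x := by
  rw [← Finset.union_sdiff_of_subset h, ind_add_of_disjoint Finset.disjoint_sdiff, conv_add_right]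
  exact le_add_of_nonneg_right (conv_nonneg (ind_nonneg _) (ind_nonneg _) x)

/-- The decomposition behind the Dyson transform. -/
lemma conv_ind_eq_transform (A B : Finset (ZMod p)) :
    conv (ind A) (ind B) =
      conv (ind (A ∪ B)) (ind (A ∩ B)) + conv (ind (A \ B)) (ind (B \ A)) := by
  have hA : ind A = ind (A \ B) + ind (A ∩ B) := by
    rw [← ind_add_of_disjoint (Finset.disjoint_sdiff_inter A B), Finset.sdiff_union_inter]
  have hB : ind B = ind (B \ A) + ind (A ∩ B) := by
    rw [Finset.inter_comm, ← ind_add_of_disjoint (Finset.disjoint_sdiff_inter B A),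
      Finset.sdiff_union_inter]
  have hU : ind (A ∪ B) = ind A + ind (B \ A) := by
    rw [← ind_add_of_disjoint Finset.disjoint_sdiff, Finset.union_sdiff_self_eq_union]
  rw [hU, hA, hB]
  simp only [conv_add_left, conv_add_right, conv_comm (ind (A ∩ B)) (ind (B \ A))]
  abel

end Convolution

section Progression

/-- The arithmetic progression `c, c + 1, ..., c + (n - 1)` in `ZMod p`. -/
noncomputable def interval (c : ZMod p) (n : ℕ) : Finset (ZMod p) :=
  (Finset.range n).image fun i : ℕ => (i : ZMod p) + c

lemma mem_interval {c x : ZMod p} {n : ℕ} : x ∈ interval c n ↔ ∃ i < n, (i : ZMod p) + c = x := by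
  simp [interval]

lemma card_interval (c : ZMod p) {n : ℕ} (hn : n ≤ p) : (interval c n).card = n := by
  rw [interval, Finset.card_image_of_injOn, Finset.card_range]
  intro i hi j hj hij
  simp only [Finset.coe_range, Set.mem_Iio] at hi hj
  have := congrArg ZMod.val (add_right_cancel hij)
  simpa only [ZMod.val_natCast, Nat.mod_eq_of_lt (hi.trans_le hn),
    Nat.mod_eq_of_lt (hj.trans_le hn)] using this

end Progression

section Pollard

variable [Fact p.Prime] [NeZero p]

lemma exists_translate_meets_not_subset {A B : Finset (ZMod p)} (hA : A.Nonempty)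
    (hA' : A.card < p) (hB : 2 ≤ B.card) :
    ∃ c : ZMod p, (∃ b ∈ B, b + c ∈ A) ∧ ∃ b ∈ B, b + c ∉ A := by
  obtain ⟨b₁, hb₁, b₂, hb₂, hne⟩ := Finset.one_lt_card.1 (show 1 < B.card by omega)
  suffices h : ∃ y ∈ A, y + (b₂ - b₁) ∉ A by
    obtain ⟨y, hy, hy'⟩ := h
    refine ⟨y - b₁, ⟨b₁, hb₁, by simpa using hy⟩, b₂, hb₂, ?_⟩
    rwa [show b₂ + (y - b₁) = y + (b₂ - b₁) by ring]
  by_contra! hcl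
  have hd : b₂ - b₁ ≠ 0 := sub_ne_zero.2 hne.symm
  obtain ⟨y, hy⟩ := hA
  have hmul : ∀ n : ℕ, y + n * (b₂ - b₁) ∈ A := by
    intro n
    induction n with
    | zero => simpa using hy
    | succ n ih =>
      convert hcl _ ih using 1
      push_cast
      ring
  have huniv : A = Finset.univ := by
    refine Finset.eq_univ_of_forall fun z => ?_
    have := hmul ((z - y) / (b₂ - b₁)).val
    rwa [ZMod.natCast_zmod_val, div_mul_cancel₀ _ hd, add_sub_cancel] at this
  rw [huniv, Finset.card_univ, ZMod.card] at hA'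
  exact lt_irrefl _ hA'

/-- **Pollard's theorem**, in the range where the truncation at `p` plays no role. -/
theorem pollard (A B : Finset (ZMod p)) (t : ℕ) (htA : t ≤ A.card) (htB : t ≤ B.card)
    (h : A.card + B.card ≤ p + t) :
    (t : ℝ) * (A.card + B.card - t) ≤ ∑ x, min (conv (ind A) (ind B) x) t := by
  induction hn : B.card using Nat.strong_induction_on generalizing A B t with
  | _ n ih =>
  subst hn
  rcases htB.eq_or_lt with rfl | hlt
  · rw [Finset.sum_congr rfl fun x _ => min_eq_left (conv_ind_le_card_right A B x), sum_conv_ind]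
    apply le_of_eq
    ring
  rcases Nat.eq_zero_or_pos t with rfl | ht
  · simp only [Nat.cast_zero, zero_mul]
    exact Finset.sum_nonneg fun x _ => le_min (conv_nonneg (ind_nonneg _) (ind_nonneg _) x) le_rfl
  obtain ⟨c, ⟨b₁, hb₁, hc₁⟩, b₂, hb₂, hc₂⟩ :=
    exists_translate_meets_not_subset (A := A) (B := B) (Finset.card_pos.1 (by omega)) (by omega)
      (by omega)
  set C : Finset (ZMod p) := B.map (Equiv.addRight c).toEmbedding with hC
  have hCcard : C.card = B.card := Finset.card_map _
  have hshift : ∑ x, min (conv (ind A) (ind B) x) t = ∑ x, min (conv (ind A) (ind C) x) t := by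
    have hindC : ind C = fun x => ind B (x - c) := by
      funext x
      simp [ind, hC, sub_eq_add_neg]
    have := conv_translate (ind A) (ind B) 0 c
    simp only [sub_zero, zero_add] at this
    rw [hindC, this]
    exact (Fintype.sum_equiv (Equiv.subRight c) _ _ fun x => rfl).symm
  rw [hshift, ← hCcard]
  have hb₁C : b₁ + c ∈ C := by simp [hC, hb₁]
  have hb₂C : b₂ + c ∈ C := by simp [hC, hb₂]
  have hIpos : 0 < (A ∩ C).card := Finset.card_pos.2 ⟨b₁ + c, Finset.mem_inter.2 ⟨hc₁, hb₁C⟩⟩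
  have hIlt : (A ∩ C).card < B.card := by
    rw [← hCcard]
    refine Finset.card_lt_card ⟨Finset.inter_subset_right, fun hs => hc₂ ?_⟩
    exact (Finset.mem_inter.1 (hs hb₂C)).1
  have hUI := Finset.card_union_add_card_inter A C
  have hAI := Finset.card_sdiff_add_card_inter A C
  have hCI := Finset.card_sdiff_add_card_inter C A
  rw [Finset.inter_comm] at hCI
  have hUI' : ((A ∪ C).card : ℝ) + (A ∩ C).card = A.card + C.card := by exact_mod_cast hUI
  have hAI' : ((A \ C).card : ℝ) + (A ∩ C).card = A.card := by exact_mod_cast hAI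
  have hCI' : ((C \ A).card : ℝ) + (A ∩ C).card = C.card := by exact_mod_cast hCI
  have hnn : ∀ x, 0 ≤ conv (ind (A \ C)) (ind (C \ A)) x :=
    conv_nonneg (ind_nonneg _) (ind_nonneg _)
  rcases le_or_gt t (A ∩ C).card with hle | hgt
  · have key := ih _ hIlt (A ∪ C) (A ∩ C) t (by omega) hle (by omega) rfl
    rw [hUI'] at key
    refine key.trans (Finset.sum_le_sum fun x _ => min_le_min_right _ ?_)
    rw [conv_ind_eq_transform A C, Pi.add_apply]
    linarith [hnn x]
  · have key := ih (C \ A).card (by omega) (A \ C) (C \ A) (t - (A ∩ C).card) (by omega) (by omega)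
      (by omega) rfl
    rw [Nat.cast_sub hgt.le] at key
    have hsum := sum_conv_ind (A ∪ C) (A ∩ C)
    calc (t : ℝ) * (A.card + C.card - t)
        = ((A ∪ C).card : ℝ) * (A ∩ C).card + ((t : ℝ) - (A ∩ C).card) *
            ((A \ C).card + (C \ A).card - ((t : ℝ) - (A ∩ C).card)) := by
          rw [← eq_sub_iff_add_eq] at hUI' hAI' hCI'
          rw [hUI', hAI', hCI']
          ring
      _ ≤ ∑ x, (conv (ind (A ∪ C)) (ind (A ∩ C)) x +
            min (conv (ind (A \ C)) (ind (C \ A)) x) ((t : ℝ) - (A ∩ C).card)) := by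
          rw [Finset.sum_add_distrib, hsum]
          linarith
      _ ≤ _ := by
          refine Finset.sum_le_sum fun x _ => ?_
          rw [conv_ind_eq_transform A C, Pi.add_apply]
          have h1 := conv_ind_le_card_right (A ∪ C) (A ∩ C) x
          have h2 := min_le_left (conv (ind (A \ C)) (ind (C \ A)) x) ((t : ℝ) - (A ∩ C).card)
          have h3 := min_le_right (conv (ind (A \ C)) (ind (C \ A)) x) ((t : ℝ) - (A ∩ C).card)
          exact le_min (by linarith) (by linarith)

open scoped Pointwise in
/-- If intervals `A' ⊆ A` and `B' ⊆ B` are `t` elements shorter and leave room for `t` exchanges,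
then the bound in Pollard's theorem is attained. -/
lemma sum_min_conv_ind_le {A B A' B' : Finset (ZMod p)} {t : ℕ}
    (hA : A'.card + t = A.card) (hB : B'.card + t = B.card)
    (hA' : ∀ y ∈ A', ∀ j ≤ t, y + (j : ℕ) ∈ A) (hB' : ∀ y ∈ B', ∀ j ≤ t, y - (j : ℕ) ∈ B) :
    ∑ x, min (conv (ind A) (ind B) x) t ≤ (t : ℝ) * (A.card + B.card - t) := by
  have hAp : A.card ≤ p := by simpa using Finset.card_le_univ A
  have key : ∀ x, min (conv (ind A) (ind B) x) t + conv (ind A') (ind B') x ≤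
      conv (ind A) (ind B) x := by
    intro x
    have hAB : conv (ind A) (ind B) x = _ := conv_ind_apply A B x
    rw [conv_ind_apply A' B' x]
    set R : Finset (ZMod p) := {y ∈ A' | x - y ∈ B'} with hR
    rcases R.eq_empty_or_nonempty with hemp | hne
    · simp [hemp]
    have hRA : R.card ≤ A'.card := Finset.card_filter_le _ _
    have hp : 0 < R.card := hne.card_pos
    have hJc : (interval (0 : ZMod p) (t + 1)).card = t + 1 := card_interval 0 (by omega)
    have hJne : (interval (0 : ZMod p) (t + 1)).Nonempty := Finset.card_pos.1 (by omega)
    have hcd := ZMod.cauchy_davenport (Fact.out : p.Prime) hne hJne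
    have hsub : R + interval 0 (t + 1) ⊆ {y ∈ A | x - y ∈ B} := by
      intro z hz
      obtain ⟨y, hy, w, hw, rfl⟩ := Finset.mem_add.1 hz
      obtain ⟨j, hj, rfl⟩ := mem_interval.1 hw
      rw [add_zero]
      obtain ⟨hy1, hy2⟩ := Finset.mem_filter.1 hy
      refine Finset.mem_filter.2 ⟨hA' y hy1 j (by omega), ?_⟩
      rw [← sub_sub]
      exact hB' _ hy2 j (by omega)
    have hle := hcd.trans (Finset.card_le_card hsub)
    rw [hJc] at hle
    have hnat : R.card + t ≤ ({y ∈ A | x - y ∈ B} : Finset (ZMod p)).card := by omega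
    have : (R.card : ℝ) + t ≤ conv (ind A) (ind B) x := by
      rw [hAB]
      exact_mod_cast hnat
    linarith [min_le_right (conv (ind A) (ind B) x) (t : ℝ)]
  have hs := Finset.sum_le_sum fun x (_ : x ∈ Finset.univ) => key x
  rw [Finset.sum_add_distrib, sum_conv_ind, sum_conv_ind] at hs
  have h1 : (A'.card : ℝ) = A.card - t := by rw [← hA]; push_cast; ring
  have h2 : (B'.card : ℝ) = B.card - t := by rw [← hB]; push_cast; ring
  rw [h1, h2] at hs
  linarith

end Pollard

section Triangle

/-- `f` is even and nonincreasing along `0, 1, 2, ..., (p - 1) / 2`. -/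
def IsTri (f : ZMod p → ℝ) : Prop :=
  (∀ z, f (-z) = f z) ∧ ∀ k : ℕ, 2 * k + 2 < p → f ((k + 1 : ℕ) : ZMod p) ≤ f (k : ZMod p)

lemma IsTri.natCast_anti {f : ZMod p → ℝ} (hf : IsTri f) {u v : ℕ} (huv : u ≤ v) (hv : 2 * v < p) :
    f v ≤ f u := by
  induction v, huv using Nat.le_induction with
  | base => exact le_rfl
  | succ v _ ih => exact (hf.2 v (by omega)).trans (ih (by omega))

lemma IsTri.natCast_anti_of_add_le {f : ZMod p → ℝ} (hf : IsTri f) (hp : Odd p) {u v : ℕ}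
    (huv : u ≤ v) (h : u + v ≤ p) : f v ≤ f u := by
  obtain ⟨d, hd⟩ := hp
  rcases lt_or_ge (2 * v) p with hv | hv
  · exact hf.natCast_anti huv hv
  · have hcast : (v : ZMod p) = -((p - v : ℕ) : ZMod p) := by
      rw [Nat.cast_sub (by omega)]
      simp
    rw [hcast, hf.1]
    exact hf.natCast_anti (by omega) (by omega)

theorem IsTri.conv [NeZero p] (hp : Odd p) {f g : ZMod p → ℝ} (hf : IsTri f) (hg : IsTri g) :
    IsTri (Paper.conv f g) := by
  refine ⟨fun z => Fintype.sum_equiv (Equiv.neg _) _ _ fun i => ?_, fun k hk => ?_⟩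
  · rw [Equiv.neg_apply, hf.1, ← hg.1 (-z - i)]
    congr 2
    ring
  set d : ZMod p → ℝ := fun j => g j - g (j + 1) with hd
  have hdneg : ∀ j, d (-1 - j) = -d j := fun j => by
    have h1 : g (-1 - j) = g (j + 1) := by rw [← hg.1]; congr 1; ring
    have h2 : g (-1 - j + 1) = g j := by rw [← hg.1]; congr 1; ring
    simp only [hd, h1, h2, neg_sub]
  have hdiff : Paper.conv f g k - Paper.conv f g ((k + 1 : ℕ) : ZMod p) =
      ∑ j, d j * f (k - j) := by
    have h1 : Paper.conv g f ((k + 1 : ℕ) : ZMod p) = ∑ j, g (j + 1) * f (k - j) :=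
      Fintype.sum_equiv (Equiv.subRight 1) _ _ fun j => by
        simp only [Equiv.subRight_apply, sub_add_cancel, Nat.cast_add, Nat.cast_one]
        congr 2
        ring
    rw [conv_comm, h1]
    simp only [Paper.conv, hd, sub_mul, Finset.sum_sub_distrib]
  have hrefl : ∑ j, d j * f (k - j) = -∑ j, d j * f (k + 1 + j) := by
    rw [← Finset.sum_neg_distrib]
    refine Fintype.sum_equiv (Equiv.subLeft (-1)) _ _ fun j => ?_
    rw [Equiv.subLeft_apply, hdneg, show (k : ZMod p) + 1 + (-1 - j) = k - j by ring]
    ring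
  have hterm : ∀ j : ℕ, 2 * j + 1 ≤ p → 0 ≤ d j * (f (k - j) - f (k + 1 + j)) := by
    intro j hj
    refine mul_nonneg ?_ ?_
    · have := hg.natCast_anti_of_add_le hp (Nat.le_succ j) (by omega)
      simpa [hd] using this
    · rw [sub_nonneg, show (k : ZMod p) + 1 + j = ((k + 1 + j : ℕ) : ZMod p) by push_cast; ring]
      rcases le_total j k with hjk | hjk
      · rw [← Nat.cast_sub hjk]
        exact hf.natCast_anti_of_add_le hp (by omega) (by omega)
      · rw [← hf.1 (k - j), neg_sub, ← Nat.cast_sub hjk]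
        exact hf.natCast_anti_of_add_le hp (by omega) (by omega)
  have hall : ∀ x : ZMod p, 0 ≤ d x * (f (k - x) - f (k + 1 + x)) := by
    intro x
    have hx := ZMod.val_lt x
    rcases le_or_gt (2 * x.val + 1) p with h | h
    · simpa using hterm x.val h
    · have hcast : ((p - 1 - x.val : ℕ) : ZMod p) = -1 - x := by
        rw [Nat.cast_sub (by omega), Nat.cast_sub (by omega)]
        simp
      have := hterm (p - 1 - x.val) (by omega)
      rw [hcast, hdneg, show (k : ZMod p) - (-1 - x) = k + 1 + x by ring,
        show (k : ZMod p) + 1 + (-1 - x) = k - x by ring] at this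
      linarith
  have hsum := Finset.sum_nonneg fun x (_ : x ∈ Finset.univ) => hall x
  simp only [mul_sub, Finset.sum_sub_distrib] at hsum
  linarith

end Triangle

section Enumeration

/-- `u` is nonincreasing along `0, 1, -1, 2, -2, ...`. -/
def IsSorted (u : ZMod p → ℝ) : Prop :=
  ∀ n : ℕ, n + 1 < p → u (plusSeq p (n + 1)) ≤ u (plusSeq p n)

lemma IsSorted.anti {u : ZMod p → ℝ} (hu : IsSorted u) {i j : ℕ} (hij : i ≤ j) (hj : j < p) :
    u (plusSeq p j) ≤ u (plusSeq p i) := by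
  induction j, hij using Nat.le_induction with
  | base => exact le_rfl
  | succ j _ ih => exact (hu j hj).trans (ih (by omega))

lemma plusSeq_two_mul (k : ℕ) : plusSeq p (2 * k) = -(k : ZMod p) := by
  rw [plusSeq, if_pos (by omega), show 2 * k / 2 = k by omega]

lemma plusSeq_two_mul_add_one (k : ℕ) : plusSeq p (2 * k + 1) = ((k + 1 : ℕ) : ZMod p) := by
  rw [plusSeq, if_neg (by omega), show (2 * k + 1 + 1) / 2 = k + 1 by omega]

lemma IsTri.plusSeq_eq {f : ZMod p → ℝ} (hf : IsTri f) (k : ℕ) :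
    f (plusSeq p (2 * k + 2)) = f (plusSeq p (2 * k + 1)) := by
  rw [show 2 * k + 2 = 2 * (k + 1) by ring, plusSeq_two_mul, plusSeq_two_mul_add_one, hf.1]

lemma IsTri.isSorted (hp : Odd p) {f : ZMod p → ℝ} (hf : IsTri f) : IsSorted f := by
  intro n hn
  obtain ⟨d, hd⟩ := hp
  obtain ⟨k, rfl | rfl⟩ := Nat.even_or_odd' n
  · rw [plusSeq_two_mul, plusSeq_two_mul_add_one, hf.1]
    exact hf.2 k (by omega)
  · exact (hf.plusSeq_eq k).le

variable [NeZero p]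

lemma valMinAbs_plusSeq {i : ℕ} (hi : i < p) :
    (plusSeq p i).valMinAbs = if i % 2 = 0 then -((i / 2 : ℕ) : ℤ) else (((i + 1) / 2 : ℕ) : ℤ) := by
  rw [ZMod.valMinAbs_spec, plusSeq, Set.mem_Ioc]
  split_ifs with h
  · exact ⟨by rw [Int.cast_neg, Int.cast_natCast], by omega, by omega⟩
  · exact ⟨by rw [Int.cast_natCast], by omega, by omega⟩

lemma plusSeq_injOn : Set.InjOn (plusSeq p) (Set.Iio p) := by
  intro i hi j hj h
  have h1 := valMinAbs_plusSeq hi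
  rw [h, valMinAbs_plusSeq hj] at h1
  split_ifs at h1 <;> omega

/-- The first `k` elements of `0, 1, -1, 2, -2, ...`. -/
noncomputable def initialSet (p k : ℕ) : Finset (ZMod p) := (Finset.range k).image (plusSeq p)

lemma sum_initialSet {k : ℕ} (hk : k ≤ p) (q : ZMod p → ℝ) :
    ∑ x ∈ initialSet p k, q x = ∑ i ∈ Finset.range k, q (plusSeq p i) :=
  Finset.sum_image fun i hi j hj h => plusSeq_injOn
    (by simp at hi; exact hi.trans_le hk) (by simp at hj; exact hj.trans_le hk) h

lemma card_initialSet {k : ℕ} (hk : k ≤ p) : (initialSet p k).card = k := by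
  have := sum_initialSet hk 1
  simp only [Pi.one_apply, Finset.sum_const, nsmul_eq_mul, mul_one, Finset.card_range] at this
  exact_mod_cast this

lemma initialSet_self : initialSet p p = Finset.univ :=
  Finset.eq_univ_of_card _ (by rw [card_initialSet le_rfl, ZMod.card])

lemma sum_plusSeq (q : ZMod p → ℝ) : ∑ i ∈ Finset.range p, q (plusSeq p i) = ∑ x, q x := by
  rw [← sum_initialSet le_rfl, initialSet_self]

lemma exists_plusSeq_eq (x : ZMod p) : ∃ i < p, plusSeq p i = x := by
  have := Finset.mem_univ x
  rw [← initialSet_self] at this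
  simpa [initialSet] using this

/-- The symmetric interval `{-m, ..., m}`. -/
noncomputable def ball (p m : ℕ) [NeZero p] : Finset (ZMod p) := {x | x.valMinAbs.natAbs ≤ m}

lemma initialSet_eq_ball {m : ℕ} (hm : 2 * m + 1 ≤ p) : initialSet p (2 * m + 1) = ball p m := by
  ext x
  obtain ⟨i, hi, rfl⟩ := exists_plusSeq_eq x
  have hv := valMinAbs_plusSeq hi
  simp only [initialSet, ball, Finset.mem_image, Finset.mem_range, Finset.mem_filter,
    Finset.mem_univ, true_and]
  constructor
  · rintro ⟨j, hj, hji⟩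
    rw [plusSeq_injOn (show j < p by omega) hi hji] at hj
    rw [hv]
    split_ifs <;> omega
  · intro h
    refine ⟨i, ?_, rfl⟩
    rw [hv] at h
    split_ifs at h <;> omega

lemma card_ball {m : ℕ} (hm : 2 * m + 1 ≤ p) : (ball p m).card = 2 * m + 1 := by
  rw [← initialSet_eq_ball hm, card_initialSet hm]

lemma ball_eq_interval {m : ℕ} (hm : 2 * m + 1 ≤ p) :
    ball p m = interval (-(m : ZMod p)) (2 * m + 1) := by
  symm
  refine Finset.eq_of_subset_of_card_le (fun x hx => ?_) (by rw [card_ball hm, card_interval _ hm])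
  obtain ⟨i, hi, rfl⟩ := mem_interval.1 hx
  have : ((i : ZMod p) + -(m : ZMod p)).valMinAbs = (i : ℤ) - m := by
    rw [ZMod.valMinAbs_spec, Set.mem_Ioc]
    exact ⟨by push_cast; ring, by omega, by omega⟩
  simp only [ball, Finset.mem_filter, Finset.mem_univ, true_and, this]
  omega

lemma isTri_ind_ball (m : ℕ) : IsTri (ind (ball p m)) := by
  refine ⟨fun z => ?_, fun k hk => ?_⟩
  · simp [ind, ball, ZMod.natAbs_valMinAbs_neg]
  · have h1 : (((k + 1 : ℕ) : ZMod p)).valMinAbs = ((k + 1 : ℕ) : ℤ) :=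
      ZMod.valMinAbs_natCast_of_le_half (by omega)
    have h2 : ((k : ZMod p)).valMinAbs = (k : ℤ) :=
      ZMod.valMinAbs_natCast_of_le_half (by omega)
    simp only [ind, ball, Finset.mem_filter, Finset.mem_univ, true_and, h1, h2, Int.natAbs_natCast]
    split_ifs <;> first | omega | norm_num

end Enumeration

section Summation

lemma sum_mul_le_sum_mul_of_partial_sums {u v w : ℕ → ℝ} {n : ℕ}
    (h : ∀ k < n, u (k + 1) = u k ∨ u (k + 1) ≤ u k ∧
      ∑ i ∈ Finset.range (k + 1), v i ≤ ∑ i ∈ Finset.range (k + 1), w i)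
    (htot : ∑ i ∈ Finset.range (n + 1), v i = ∑ i ∈ Finset.range (n + 1), w i) :
    ∑ i ∈ Finset.range (n + 1), u i * v i ≤ ∑ i ∈ Finset.range (n + 1), u i * w i := by
  have key : ∀ m ≤ n, u m * (∑ i ∈ Finset.range (m + 1), w i - ∑ i ∈ Finset.range (m + 1), v i) ≤
      ∑ i ∈ Finset.range (m + 1), u i * w i - ∑ i ∈ Finset.range (m + 1), u i * v i := by
    intro m hm
    induction m with
    | zero => simp [mul_sub]
    | succ m ih =>
      have ih := ih (by omega)
      rw [Finset.sum_range_succ _ (m + 1), Finset.sum_range_succ _ (m + 1),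
        Finset.sum_range_succ _ (m + 1), Finset.sum_range_succ _ (m + 1)]
      rcases h m (by omega) with he | ⟨hle, hs⟩
      · rw [he]
        linarith
      · nlinarith [mul_nonneg (sub_nonneg.2 hle) (sub_nonneg.2 hs)]
  have := key n le_rfl
  rw [htot, sub_self, mul_zero] at this
  linarith

variable [NeZero p]

/-- A rearrangement bound: it suffices to compare sums over sets of each size at which `u`
strictly decreases. -/
lemma IsSorted.sum_comp_mul_le {u q' q : ZMod p → ℝ} (hu : IsSorted u)
    (hpre : ∀ k, k + 1 < p → u (plusSeq p (k + 1)) = u (plusSeq p k) ∨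
      ∀ B : Finset (ZMod p), B.card = k + 1 → ∑ x ∈ B, q' x ≤ ∑ x ∈ initialSet p (k + 1), q x)
    (htot : ∑ x, q' x = ∑ x, q x) (σ : Equiv.Perm (ZMod p)) :
    ∑ x, u (σ x) * q' x ≤ ∑ x, u x * q x := by
  have hσ : ∑ x, u (σ x) * q' x = ∑ x, u x * q' (σ.symm x) :=
    Fintype.sum_equiv σ _ _ fun x => by simp
  obtain ⟨n, rfl⟩ : ∃ n, p = n + 1 := Nat.exists_eq_succ_of_ne_zero (NeZero.ne p)
  rw [hσ, ← sum_plusSeq, ← sum_plusSeq fun x => u x * q x]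
  refine sum_mul_le_sum_mul_of_partial_sums (u := fun i => u (plusSeq (n + 1) i))
    (v := fun i => q' (σ.symm (plusSeq (n + 1) i))) (w := fun i => q (plusSeq (n + 1) i)) ?_ ?_
  · intro k hk
    refine (hpre k (by omega)).imp_right fun h => ⟨hu k (by omega), ?_⟩
    have := h ((initialSet (n + 1) (k + 1)).map σ.symm.toEmbedding)
      (by rw [Finset.card_map, card_initialSet (by omega)])
    rw [Finset.sum_map, sum_initialSet (by omega), sum_initialSet (by omega)] at this
    exact this
  · rw [sum_plusSeq fun x => q' (σ.symm x), sum_plusSeq q, ← htot]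
    exact Equiv.sum_comp σ.symm q'

lemma IsTri.sum_comp_mul_le (hp : Odd p) {f q' q : ZMod p → ℝ} (hf : IsTri f)
    (hpre : ∀ m, 2 * m + 1 ≤ p →
      ∀ B : Finset (ZMod p), B.card = 2 * m + 1 → ∑ x ∈ B, q' x ≤ ∑ x ∈ ball p m, q x)
    (htot : ∑ x, q' x = ∑ x, q x) (σ : Equiv.Perm (ZMod p)) :
    ∑ x, f (σ x) * q' x ≤ ∑ x, f x * q x := by
  refine (hf.isSorted hp).sum_comp_mul_le (fun k hk => ?_) htot σ
  obtain ⟨m, rfl | rfl⟩ := Nat.even_or_odd' k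
  · right
    rw [initialSet_eq_ball (by omega)]
    exact hpre m (by omega)
  · exact Or.inl (hf.plusSeq_eq m)

end Summation

section Rearrangement

variable [Fact p.Prime] [NeZero p]

lemma sum_min_conv_ball_le {m l t : ℕ} (hm : 2 * m + 1 ≤ p) (hl : 2 * l + 1 ≤ p)
    (htm : t ≤ 2 * m + 1) (htl : t ≤ 2 * l + 1) :
    ∑ x, min (conv (ind (ball p m)) (ind (ball p l)) x) t ≤
      (t : ℝ) * ((ball p m).card + (ball p l).card - t) := by
  refine sum_min_conv_ind_le (A' := interval (-(m : ZMod p)) (2 * m + 1 - t))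
    (B' := interval ((t : ZMod p) + -(l : ZMod p)) (2 * l + 1 - t)) ?_ ?_ ?_ ?_
  · rw [card_ball hm, card_interval _ (by omega)]
    omega
  · rw [card_ball hl, card_interval _ (by omega)]
    omega
  · intro y hy j hj
    obtain ⟨i, hi, rfl⟩ := mem_interval.1 hy
    rw [ball_eq_interval hm]
    exact mem_interval.2 ⟨i + j, by omega, by push_cast; ring⟩
  · intro y hy j hj
    obtain ⟨i, hi, rfl⟩ := mem_interval.1 hy
    rw [ball_eq_interval hl]
    exact mem_interval.2 ⟨i + (t - j), by omega, by push_cast [Nat.cast_sub hj]; ring⟩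

lemma sum_min_conv_ball_le_sum_min_conv {m l t : ℕ} (hm : 2 * m + 1 ≤ p) (hl : 2 * l + 1 ≤ p)
    (htm : t ≤ 2 * m + 1) (htl : t ≤ 2 * l + 1) {A B : Finset (ZMod p)}
    (hA : A.card = 2 * m + 1) (hB : B.card = 2 * l + 1) :
    ∑ x, min (conv (ind (ball p m)) (ind (ball p l)) x) t ≤
      ∑ x, min (conv (ind A) (ind B) x) t := by
  rcases le_or_gt (A.card + B.card) (p + t) with h | h
  · refine (sum_min_conv_ball_le hm hl htm htl).trans ?_
    rw [card_ball hm, card_ball hl, ← hA, ← hB]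
    exact pollard A B t (by omega) (by omega) h
  · obtain ⟨C, hCB, hC⟩ := Finset.exists_subset_card_eq (show p + t - A.card ≤ B.card by omega)
    have hCt : (A.card : ℝ) + C.card = p + t := by
      have : A.card + C.card = p + t := by omega
      exact_mod_cast this
    have key := pollard A C t (by omega) (by omega) (by omega)
    rw [hCt, add_sub_cancel_right] at key
    calc ∑ x, min (conv (ind (ball p m)) (ind (ball p l)) x) (t : ℝ)
        ≤ ∑ _x : ZMod p, (t : ℝ) := Finset.sum_le_sum fun x _ => min_le_right _ _
      _ = t * p := by simp [mul_comm]
      _ ≤ _ := key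
      _ ≤ _ := Finset.sum_le_sum fun x _ => min_le_min_right _ (conv_ind_mono_right A hCB x)

/-- Convolutions of sets of odd cardinality are majorized by those of symmetric intervals. -/
lemma sum_conv_ind_le_sum_initialSet (hp : Odd p) {m l : ℕ} (hm : 2 * m + 1 ≤ p)
    (hl : 2 * l + 1 ≤ p) {A B : Finset (ZMod p)} (hA : A.card = 2 * m + 1)
    (hB : B.card = 2 * l + 1) (S : Finset (ZMod p)) :
    ∑ x ∈ S, conv (ind A) (ind B) x ≤
      ∑ x ∈ initialSet p S.card, conv (ind (ball p m)) (ind (ball p l)) x := by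
  set r := conv (ind A) (ind B) with hr
  set r' := conv (ind (ball p m)) (ind (ball p l)) with hr'
  have hSp : S.card ≤ p := by simpa using Finset.card_le_univ S
  rcases S.eq_empty_or_nonempty with rfl | hS
  · simp [initialSet]
  have hS1 := hS.card_pos
  have hsorted : IsSorted r' := ((isTri_ind_ball m).conv hp (isTri_ind_ball l)).isSorted hp
  obtain ⟨t, ht⟩ : ∃ t : ℕ, r' (plusSeq p (S.card - 1)) = t := ⟨_, conv_ind_apply _ _ _⟩
  have htm : t ≤ 2 * m + 1 := by
    have := conv_ind_le_card_left (ball p m) (ball p l) (plusSeq p (S.card - 1))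
    rw [← hr', ht, card_ball hm] at this
    exact_mod_cast this
  have htl : t ≤ 2 * l + 1 := by
    have := conv_ind_le_card_right (ball p m) (ball p l) (plusSeq p (S.card - 1))
    rw [← hr', ht, card_ball hl] at this
    exact_mod_cast this
  have hmin := sum_min_conv_ball_le_sum_min_conv hm hl htm htl hA hB
  have htot : ∑ x, r x = ∑ x, r' x := by
    rw [hr, hr', sum_conv_ind, sum_conv_ind, hA, hB, card_ball hm, card_ball hl]
  have hexcess : ∑ x, (r' x - min (r' x) t) = ∑ x ∈ initialSet p S.card, (r' x - t) := by
    rw [← Finset.sum_subset (Finset.subset_univ (initialSet p S.card))]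
    · refine Finset.sum_congr rfl fun x hx => ?_
      obtain ⟨i, hi, rfl⟩ := Finset.mem_image.1 hx
      rw [Finset.mem_range] at hi
      rw [min_eq_right]
      rw [← ht]
      exact hsorted.anti (by omega) (by omega)
    · intro x _ hx
      obtain ⟨i, hi, rfl⟩ := exists_plusSeq_eq x
      have hSi : S.card ≤ i := by
        by_contra! h
        exact hx (Finset.mem_image_of_mem _ (Finset.mem_range.2 h))
      rw [min_eq_left, sub_self]
      rw [← ht]
      exact hsorted.anti (by omega) hi
  calc ∑ x ∈ S, r x ≤ ∑ x ∈ S, ((t : ℝ) + (r x - min (r x) t)) :=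
        Finset.sum_le_sum fun x _ => by linarith [min_le_right (r x) (t : ℝ)]
    _ = S.card * t + ∑ x ∈ S, (r x - min (r x) t) := by
        rw [Finset.sum_add_distrib, Finset.sum_const, nsmul_eq_mul]
    _ ≤ S.card * t + ∑ x, (r x - min (r x) t) := by
        have hsub : ∑ x ∈ S, (r x - min (r x) (t : ℝ)) ≤ ∑ x, (r x - min (r x) (t : ℝ)) :=
          Finset.sum_le_sum_of_subset_of_nonneg (Finset.subset_univ S) fun x _ _ => by
            linarith [min_le_left (r x) (t : ℝ)]
        linarith
    _ ≤ S.card * t + ∑ x, (r' x - min (r' x) t) := by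
        rw [Finset.sum_sub_distrib, Finset.sum_sub_distrib, htot]
        linarith
    _ = ∑ x ∈ initialSet p S.card, r' x := by
        rw [hexcess, Finset.sum_sub_distrib, Finset.sum_const, card_initialSet hSp, nsmul_eq_mul]
        ring

/-- A Riesz rearrangement inequality on `ZMod p`. -/
theorem sum_conv_comp_mul_comp_le (hp : Odd p) {f g h : ZMod p → ℝ} (hf : IsTri f) (hg : IsTri g)
    (hh : IsSorted h) (σ τ ρ : Equiv.Perm (ZMod p)) :
    ∑ x, conv (f ∘ σ) (g ∘ τ) x * h (ρ x) ≤ ∑ x, conv f g x * h x := by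
  have hcorr : ∀ (f : ZMod p → ℝ) (h : ZMod p → ℝ) (B : Finset (ZMod p)),
      ∑ y ∈ B, ∑ z, f z * h (z + y) = ∑ x, conv f (ind B) x * h x := fun f h B => by
    rw [sum_conv_mul, sum_ind_mul]
  have hcorr_univ : ∀ f h : ZMod p → ℝ, ∑ y, ∑ z, f z * h (z + y) = (∑ z, f z) * ∑ y, h y := by
    intro f h
    rw [Finset.sum_comm, Finset.sum_mul]
    refine Finset.sum_congr rfl fun z _ => ?_
    rw [← Finset.mul_sum]
    exact congrArg _ (Equiv.sum_comp (Equiv.addLeft z) h)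
  have h1 : ∀ m l, 2 * m + 1 ≤ p → 2 * l + 1 ≤ p → ∀ A B : Finset (ZMod p),
      A.card = 2 * m + 1 → B.card = 2 * l + 1 →
      ∑ x, conv (ind A) (ind B) x * h (ρ x) ≤
        ∑ x, conv (ind (ball p m)) (ind (ball p l)) x * h x := by
    intro m l hm hl A B hA hB
    simp only [mul_comm _ (h _)]
    refine hh.sum_comp_mul_le (fun k hk => Or.inr fun S hS => ?_) ?_ ρ
    · rw [← hS]
      exact sum_conv_ind_le_sum_initialSet hp hm hl hA hB S
    · rw [sum_conv_ind, sum_conv_ind, hA, hB, card_ball hm, card_ball hl]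
  have h2 : ∀ m, 2 * m + 1 ≤ p → ∀ A : Finset (ZMod p), A.card = 2 * m + 1 →
      ∑ x, conv (g ∘ τ) (ind A) x * h (ρ x) ≤ ∑ x, conv g (ind (ball p m)) x * h x := by
    intro m hm A hA
    rw [conv_comm, conv_comm g, sum_conv_mul, sum_conv_mul]
    refine hg.sum_comp_mul_le hp (fun l hl B hB => ?_) ?_ τ
    · rw [hcorr _ (fun x => h (ρ x)), hcorr]
      exact h1 m l hm hl A B hA hB
    · rw [hcorr_univ _ (fun x => h (ρ x)), hcorr_univ, Equiv.sum_comp ρ h, sum_ind, sum_ind, hA,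
        card_ball hm]
  rw [conv_comm, conv_comm f, sum_conv_mul, sum_conv_mul]
  refine hf.sum_comp_mul_le hp (fun m hm A hA => ?_) ?_ σ
  · rw [hcorr _ (fun x => h (ρ x)), hcorr]
    exact h2 m hm A hA
  · rw [hcorr_univ _ (fun x => h (ρ x)), hcorr_univ, Equiv.sum_comp ρ h]
    exact congrArg (· * _) (Equiv.sum_comp τ g)

end Rearrangement

section PermHull

lemma isTri_delta : IsTri fun k : ZMod p => if k = 0 then (1 : ℝ) else 0 := by
  refine ⟨fun z => by simp, fun k hk => ?_⟩
  have hne : ((k + 1 : ℕ) : ZMod p) ≠ 0 := by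
    rw [Ne, ZMod.natCast_eq_zero_iff]
    exact fun h => absurd (Nat.le_of_dvd (by omega) h) (by omega)
  simp only [hne, if_false]
  split_ifs <;> norm_num

/-- The convex hull of all rearrangements of `G`; by the Hardy-Littlewood-Pólya theorem these are
the functions majorized by `G`. -/
def permHull (G : ZMod p → ℝ) : Set (ZMod p → ℝ) :=
  convexHull ℝ (Set.range fun σ : Equiv.Perm (ZMod p) => G ∘ σ)

lemma comp_mem_permHull (G : ZMod p → ℝ) (σ : Equiv.Perm (ZMod p)) : G ∘ σ ∈ permHull G :=
  subset_convexHull ℝ _ ⟨σ, rfl⟩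

lemma permHull_subset {G : ZMod p → ℝ} {s : Set (ZMod p → ℝ)} (hs : Convex ℝ s)
    (h : ∀ σ : Equiv.Perm (ZMod p), G ∘ σ ∈ s) : permHull G ⊆ s :=
  convexHull_min (Set.range_subset_iff.2 h) hs

lemma permHull_comp (G : ZMod p → ℝ) (σ : Equiv.Perm (ZMod p)) : permHull G ⊆ permHull (G ∘ σ) :=
  permHull_subset (convex_convexHull ℝ _) fun τ => by
    convert comp_mem_permHull (G ∘ σ) (τ.trans σ.symm) using 1
    funext x
    simp

lemma map_mem_permHull (L : (ZMod p → ℝ) →ₗ[ℝ] (ZMod p → ℝ)) {F G H : ZMod p → ℝ}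
    (h : ∀ σ : Equiv.Perm (ZMod p), L (G ∘ σ) ∈ permHull H) (hF : F ∈ permHull G) :
    L F ∈ permHull H :=
  permHull_subset (s := L ⁻¹' permHull H) ((convex_convexHull ℝ _).linear_preimage L) h hF

lemma smul_mem_permHull (c : ℝ) {F G : ZMod p → ℝ} (hF : F ∈ permHull G) :
    c • F ∈ permHull (c • G) :=
  map_mem_permHull (c • LinearMap.id) (fun σ => comp_mem_permHull (c • G) σ) hF

/-- The enumeration `0, 1, -1, 2, -2, ...` as an equivalence. -/
noncomputable def plusEquiv (p : ℕ) [NeZero p] : Fin p ≃ ZMod p :=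
  Equiv.ofBijective (fun i : Fin p => plusSeq p i) <| by
    rw [Fintype.bijective_iff_injective_and_card]
    exact ⟨fun i j hij => Fin.ext (plusSeq_injOn i.2 j.2 hij), by simp [ZMod.card]⟩

lemma exists_perm_isSorted [NeZero p] (h : ZMod p → ℝ) :
    ∃ ρ : Equiv.Perm (ZMod p), IsSorted (h ∘ ρ) := by
  let e := plusEquiv p
  let s : Equiv.Perm (Fin p) := Tuple.sort fun i => -h (e i)
  have hs : Monotone ((fun i => -h (e i)) ∘ s) := Tuple.monotone_sort _
  refine ⟨(e.symm.trans s).trans e, fun n hn => ?_⟩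
  have he : ∀ k (hk : k < p), e.symm (plusSeq p k) = ⟨k, hk⟩ := fun k hk => by
    rw [Equiv.symm_apply_eq]
    rfl
  have := hs (show (⟨n, by omega⟩ : Fin p) ≤ ⟨n + 1, hn⟩ from Nat.le_succ n)
  simp only [Function.comp_apply, Equiv.trans_apply, he n (by omega), he (n + 1) hn]
  simpa using this

/-- `f` is a translate of a scalar multiple of a function satisfying `IsTri`. -/
def IsShiftTri (f : ZMod p → ℝ) : Prop :=
  ∃ (s : ℝ) (c : ZMod p) (f₀ : ZMod p → ℝ), IsTri f₀ ∧ f = s • fun x => f₀ (x - c)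

variable [Fact p.Prime] [NeZero p]

theorem IsTri.conv_comp_mem_permHull (hp : Odd p) {f g : ZMod p → ℝ} (hf : IsTri f) (hg : IsTri g)
    (σ τ : Equiv.Perm (ZMod p)) : Paper.conv (f ∘ σ) (g ∘ τ) ∈ permHull (Paper.conv f g) := by
  by_contra hnot
  obtain ⟨φ, u, hφ, hu⟩ := geometric_hahn_banach_closed_point (convex_convexHull ℝ _)
    ((Set.finite_range _).isClosed_convexHull ℝ) hnot
  set h : ZMod p → ℝ := fun i => φ fun j => if i = j then 1 else 0 with hh
  have hφh : ∀ v, φ v = ∑ x, v x * h x := fun v => by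
    have := LinearMap.pi_apply_eq_sum_univ (φ : (ZMod p → ℝ) →ₗ[ℝ] ℝ) v
    simpa [hh] using this
  obtain ⟨ρ, hρ⟩ := exists_perm_isSorted h
  have key := sum_conv_comp_mul_comp_le hp hf hg hρ σ τ ρ.symm
  have h1 := hφ _ (comp_mem_permHull (Paper.conv f g) ρ.symm)
  rw [hφh] at h1 hu
  have h2 : ∑ x, Paper.conv f g x * (h ∘ ρ) x =
      ∑ x, (Paper.conv f g ∘ ρ.symm) x * h x :=
    Fintype.sum_equiv ρ _ _ fun x => by simp
  simp only [Function.comp_apply, Equiv.apply_symm_apply] at key h1 h2 hu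
  linarith

theorem IsShiftTri.conv (hp : Odd p) {f g : ZMod p → ℝ} (hf : IsShiftTri f) (hg : IsShiftTri g) :
    IsShiftTri (Paper.conv f g) := by
  obtain ⟨s, c, f₀, hf₀, rfl⟩ := hf
  obtain ⟨s', c', g₀, hg₀, rfl⟩ := hg
  refine ⟨s * s', c + c', _, hf₀.conv hp hg₀, ?_⟩
  rw [conv_smul_left, conv_smul_right, smul_smul, conv_translate]

theorem IsShiftTri.conv_comp_mem_permHull (hp : Odd p) {f g : ZMod p → ℝ} (hf : IsShiftTri f)
    (hg : IsShiftTri g) (σ τ : Equiv.Perm (ZMod p)) :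
    Paper.conv (f ∘ σ) (g ∘ τ) ∈ permHull (Paper.conv f g) := by
  obtain ⟨s, c, f₀, hf₀, rfl⟩ := hf
  obtain ⟨s', c', g₀, hg₀, rfl⟩ := hg
  have h := smul_mem_permHull (s * s') (permHull_comp _ (Equiv.subRight (c + c'))
    (hf₀.conv_comp_mem_permHull hp hg₀ (σ.trans (Equiv.subRight c)) (τ.trans (Equiv.subRight c'))))
  have h1 : Paper.conv ((s • fun x => f₀ (x - c)) ∘ σ) ((s' • fun x => g₀ (x - c')) ∘ τ) =
      (s * s') • Paper.conv (f₀ ∘ σ.trans (Equiv.subRight c))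
        (g₀ ∘ τ.trans (Equiv.subRight c')) := by
    rw [← smul_smul, ← conv_smul_right, ← conv_smul_left]
    rfl
  rw [h1, conv_smul_left, conv_smul_right, smul_smul, conv_translate]
  exact h

theorem IsShiftTri.conv_mem_permHull (hp : Odd p) {f g G : ZMod p → ℝ} (hf : IsShiftTri f)
    (hg : IsShiftTri g) (σ : Equiv.Perm (ZMod p)) (hG : G ∈ permHull g) :
    Paper.conv (f ∘ σ) G ∈ permHull (Paper.conv f g) :=
  map_mem_permHull
    { toFun := Paper.conv (f ∘ σ)
      map_add' := conv_add_right _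
      map_smul' := fun c g => conv_smul_right c _ g }
    (fun τ => hf.conv_comp_mem_permHull hp hg σ τ) hG

theorem convList_mem_permHull (hp : Odd p) {n : ℕ} (f g : Fin n → ZMod p → ℝ)
    (hf : ∀ i, IsShiftTri (f i)) (hg : ∀ i, ∃ σ : Equiv.Perm (ZMod p), g i = f i ∘ σ) :
    IsShiftTri (convList (List.ofFn f)) ∧
      convList (List.ofFn g) ∈ permHull (convList (List.ofFn f)) := by
  induction n with
  | zero =>
    simp only [List.ofFn_zero, convList, List.foldr_nil]
    exact ⟨⟨1, 0, _, isTri_delta, by simp⟩, comp_mem_permHull _ (Equiv.refl _)⟩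
  | succ n ih =>
    obtain ⟨h1, h2⟩ := ih (fun i => f i.succ) (fun i => g i.succ) (fun i => hf _) (fun i => hg _)
    obtain ⟨σ, hσ⟩ := hg 0
    rw [List.ofFn_succ, List.ofFn_succ]
    refine ⟨(hf 0).conv hp h1, ?_⟩
    have := (hf 0).conv_mem_permHull hp h1 σ h2
    rwa [← hσ] at this

end PermHull

section Regular

lemma IsSorted.isTri {f : ZMod p → ℝ} (hf : IsSorted f) (hsymm : ∀ z, f (-z) = f z) : IsTri f := by
  refine ⟨hsymm, fun k hk => ?_⟩
  have := hf (2 * k) (by omega)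
  rwa [plusSeq_two_mul, plusSeq_two_mul_add_one, hsymm] at this

lemma IsSorted.isTri_neg_of_reflection {f : ZMod p → ℝ} {d : ℕ} (hp : p = 2 * d + 1)
    (hf : IsSorted f) (hsymm : ∀ z, f (1 - z) = f z) :
    IsTri fun z : ZMod p => -f (z + ((d + 1 : ℕ) : ZMod p)) := by
  have hd : (2 : ZMod p) * d + 1 = 0 := by
    have : ((2 * d + 1 : ℕ) : ZMod p) = 0 := by
      rw [← hp]
      exact ZMod.natCast_self p
    exact_mod_cast this
  refine ⟨fun z => ?_, fun k hk => neg_le_neg ?_⟩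
  · change -f (-z + ((d + 1 : ℕ) : ZMod p)) = -f (z + ((d + 1 : ℕ) : ZMod p))
    rw [← hsymm (z + ((d + 1 : ℕ) : ZMod p))]
    congr 2
    push_cast
    linear_combination hd
  · have key : ∀ j ≤ d, (j : ZMod p) + ((d + 1 : ℕ) : ZMod p) = plusSeq p (2 * (d - j)) := by
      intro j hj
      rw [plusSeq_two_mul]
      push_cast [Nat.cast_sub hj]
      linear_combination hd
    rw [key k (by omega), key (k + 1) (by omega)]
    exact hf.anti (by omega) (by omega)

variable [NeZero p]

lemma IsSorted.comp_eq_self {u : ZMod p → ℝ} {σ : Equiv.Perm (ZMod p)} (hu : IsSorted u)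
    (hσ : IsSorted (u ∘ σ)) : u ∘ σ = u := by
  let e := plusEquiv p
  have h1 : Monotone ((fun i => -u (e i)) ∘ (1 : Equiv.Perm (Fin p))) := fun i j hij =>
    neg_le_neg (hu.anti hij j.2)
  have h2 : Monotone ((fun i => -u (e i)) ∘ ((e.trans σ).trans e.symm : Equiv.Perm (Fin p))) :=
    fun i j hij => by
      have := hσ.anti hij j.2
      simp only [Function.comp_apply, Equiv.trans_apply, Equiv.apply_symm_apply]
      exact neg_le_neg this
  have h := Tuple.unique_monotone h1 h2
  funext x
  have hx := congrFun h (e.symm x)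
  simpa using hx.symm

lemma IsPlusRearr.eq_of_isSorted {f fp g : ZMod p → ℝ} (hfp : IsPlusRearr f fp) (hg : IsSorted g)
    (hgf : ∃ σ : Equiv.Perm (ZMod p), g = f ∘ σ) : g = fp := by
  obtain ⟨⟨σ, rfl⟩, hs⟩ := hfp
  obtain ⟨τ, rfl⟩ := hgf
  have heq : f ∘ τ = (f ∘ σ) ∘ (τ.trans σ.symm) := by funext x; simp
  rw [heq] at hg ⊢
  exact IsSorted.comp_eq_self hs hg

lemma IsPlusRearr.comp_neg_eq {f fp fm : ZMod p → ℝ} (hfp : IsPlusRearr f fp)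
    (hfm : IsMinusRearr f fm) (z : ZMod p) : fm (-z) = fp z := by
  obtain ⟨⟨τ, rfl⟩, hs⟩ := hfm
  exact congrFun (hfp.eq_of_isSorted (g := fun z => (f ∘ τ) (-z)) hs
    ⟨(Equiv.neg _).trans τ, rfl⟩) z

lemma IsPlusRearr.eq_or_eq_comp_neg {f fp : ZMod p → ℝ} (hfp : IsPlusRearr f fp)
    (hself : IsPlusRearr f f ∨ IsMinusRearr f f) : f = fp ∨ f = fun z => fp (-z) := by
  refine hself.imp (fun h => hfp.eq_of_isSorted h.2 ⟨Equiv.refl _, rfl⟩) fun h => ?_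
  funext z
  rw [← hfp.comp_neg_eq h, neg_neg]

theorem isShiftTri_of_regular (hp : Odd p) {f : ZMod p → ℝ}
    (hreg : TriangleRegular f ∨ SquareRegular f) (hself : IsPlusRearr f f ∨ IsMinusRearr f f) :
    IsShiftTri f := by
  rcases hreg with ⟨fp, hfp, hsymm⟩ | ⟨fp, fm, hfp, hfm, hshift⟩
  · have hf : f = fp := by
      rcases hfp.eq_or_eq_comp_neg hself with h | h
      · exact h
      · exact h.trans (funext hsymm)
    exact ⟨1, 0, fp, IsSorted.isTri hfp.2 hsymm, by simp [hf]⟩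
  · obtain ⟨d, hd⟩ := hp
    have hrefl : ∀ z, fp (1 - z) = fp z := fun z => by
      rw [← hfp.comp_neg_eq hfm z, ← hshift]
      congr 1
      ring
    have htri := IsSorted.isTri_neg_of_reflection hd hfp.2 hrefl
    rcases hfp.eq_or_eq_comp_neg hself with h | h
    · exact ⟨-1, ((d + 1 : ℕ) : ZMod p), _, htri, by funext z; simp [h]⟩
    · refine ⟨-1, ((d + 1 : ℕ) : ZMod p) - 1, _, htri, ?_⟩
      funext z
      simp only [h, Pi.smul_apply, smul_eq_mul, neg_mul, one_mul, neg_neg]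
      rw [← hrefl]
      congr 1
      ring

end Regular

section Entropy

variable [NeZero p]

lemma sum_le_sum_of_mem_permHull {φ : ℝ → ℝ} (hφ : ConcaveOn ℝ (Set.Ici 0) φ) {F G : ZMod p → ℝ}
    (hG : ∀ x, 0 ≤ G x) (hF : F ∈ permHull G) : ∑ x, φ (G x) ≤ ∑ x, φ (F x) := by
  let s : Set (ZMod p → ℝ) := {F | (∀ x, 0 ≤ F x) ∧ ∑ x, φ (G x) ≤ ∑ x, φ (F x)}
  have hs : Convex ℝ s := by
    rintro F ⟨hF, hFs⟩ F' ⟨hF', hFs'⟩ a b ha hb hab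
    refine ⟨fun x => add_nonneg (mul_nonneg ha (hF x)) (mul_nonneg hb (hF' x)), ?_⟩
    calc ∑ x, φ (G x) = a * ∑ x, φ (G x) + b * ∑ x, φ (G x) := by rw [← add_mul, hab, one_mul]
      _ ≤ a * ∑ x, φ (F x) + b * ∑ x, φ (F' x) := by gcongr
      _ = ∑ x, (a * φ (F x) + b * φ (F' x)) := by
        rw [Finset.sum_add_distrib, Finset.mul_sum, Finset.mul_sum]
      _ ≤ _ := Finset.sum_le_sum fun x _ => hφ.2 (hF x) (hF' x) ha hb hab
  exact (permHull_subset hs (fun σ => ⟨fun x => hG _,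
    (Equiv.sum_comp σ fun x => φ (G x)).ge⟩) hF).2

lemma concaveOn_ite_ne_zero :
    ConcaveOn ℝ (Set.Ici 0) fun x : ℝ => if x ≠ 0 then (1 : ℝ) else 0 := by
  refine ⟨convex_Ici 0, fun x hx y hy a b ha hb hab => ?_⟩
  have hx' : 0 ≤ a * x := mul_nonneg ha hx
  have hy' : 0 ≤ b * y := mul_nonneg hb hy
  simp only [smul_eq_mul]
  by_cases h : a * x + b * y = 0
  · have hax : a * x = 0 := by linarith
    have hby : b * y = 0 := by linarith
    rcases mul_eq_zero.1 hax with h1 | h1 <;> rcases mul_eq_zero.1 hby with h2 | h2 <;>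
      simp [h1, h2]
  · rw [if_pos h]
    split_ifs <;> linarith

lemma IsPMF.exists_pos {F : ZMod p → ℝ} (hF : IsPMF F) : ∃ x, 0 < F x := by
  by_contra! h
  have := Finset.sum_nonpos fun x (_ : x ∈ Finset.univ) => h x
  rw [hF.2] at this
  linarith

lemma IsPMF.sum_rpow_pos {F : ZMod p → ℝ} (hF : IsPMF F) (a : ℝ) : 0 < ∑ x, F x ^ a := by
  obtain ⟨x, hx⟩ := hF.exists_pos
  exact Finset.sum_pos' (fun y _ => Real.rpow_nonneg (hF.1 y) a)
    ⟨x, Finset.mem_univ x, Real.rpow_pos_of_pos hx a⟩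

/-- Rényi entropies are Schur-concave. -/
theorem renyi_le_of_mem_permHull {F G : ZMod p → ℝ} (hF : IsPMF F) (hG : IsPMF G)
    (hFG : F ∈ permHull G) (α : ℝ≥0∞) : renyi α G ≤ renyi α F := by
  unfold renyi
  split_ifs with h0 h1 htop
  · have h := sum_le_sum_of_mem_permHull concaveOn_ite_ne_zero hG.1 hFG
    rw [Finset.sum_boole, Finset.sum_boole] at h
    obtain ⟨x, hx⟩ := hG.exists_pos
    have hpos : 0 < (Finset.univ.filter fun i => G i ≠ 0).card :=
      Finset.card_pos.2 ⟨x, by simpa using hx.ne'⟩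
    exact Real.log_le_log (by exact_mod_cast hpos) h
  · exact sum_le_sum_of_mem_permHull Real.concaveOn_negMulLog hG.1 hFG
  · have hbdd : ∀ H : ZMod p → ℝ, BddAbove (Set.range H) := fun H => (Set.finite_range H).bddAbove
    have hle : ∀ x, F x ≤ ⨆ i, G i := fun x =>
      permHull_subset (s := {H | H x ≤ ⨆ i, G i})
        (convex_halfSpace_le (LinearMap.proj (R := ℝ) (φ := fun _ => ℝ) x).isLinear _)
        (fun σ => le_ciSup (hbdd G) (σ x)) hFG
    obtain ⟨x, hx⟩ := hF.exists_pos
    exact neg_le_neg (Real.log_le_log (hx.trans_le (le_ciSup (hbdd F) x)) (ciSup_le hle))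
  · have hne : α.toReal ≠ 1 := fun h => h1 ((ENNReal.toReal_eq_one_iff α).1 h)
    rcases lt_or_gt_of_ne hne with hlt | hgt
    · have h := sum_le_sum_of_mem_permHull (Real.concaveOn_rpow ENNReal.toReal_nonneg hlt.le)
        hG.1 hFG
      exact mul_le_mul_of_nonneg_left (Real.log_le_log (hG.sum_rpow_pos _) h)
        (inv_nonneg.2 (by linarith))
    · have h := sum_le_sum_of_mem_permHull (convexOn_rpow hgt.le).neg hG.1 hFG
      simp only [Pi.neg_apply, Finset.sum_neg_distrib, neg_le_neg_iff] at h
      exact mul_le_mul_of_nonpos_left (Real.log_le_log (hF.sum_rpow_pos _) h)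
        (inv_nonpos.2 (by linarith))

lemma IsPMF.comp {f : ZMod p → ℝ} (hf : IsPMF f) (σ : Equiv.Perm (ZMod p)) : IsPMF (f ∘ σ) :=
  ⟨fun _ => hf.1 _, (Equiv.sum_comp σ f).trans hf.2⟩

lemma isPMF_convList_ofFn {n : ℕ} {f : Fin n → ZMod p → ℝ} (hf : ∀ i, IsPMF (f i)) :
    IsPMF (convList (List.ofFn f)) := by
  induction n with
  | zero =>
    refine ⟨fun k => ?_, ?_⟩
    · simp only [convList, List.ofFn_zero, List.foldr_nil]
      split_ifs <;> norm_num
    · simp [convList]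
  | succ n ih =>
    have h := ih (f := fun i => f i.succ) fun i => hf _
    rw [List.ofFn_succ]
    refine ⟨conv_nonneg (hf 0).1 h.1, ?_⟩
    change ∑ x, conv (f 0) (convList (List.ofFn fun i => f i.succ)) x = 1
    rw [sum_conv, (hf 0).2, h.2, one_mul]

end Entropy

/-- If each pmf `fᵢ` is `△`- or `□`-regular and equals its own `+` or `-` rearrangement,
then for any nonzero `a₁, ..., aₙ ∈ ZMod p` and any `α ∈ [0,∞]`,
`H_α(a₁X₁ ⊕ ⋯ ⊕ aₙXₙ) ≥ H_α(X₁ ⊕ ⋯ ⊕ Xₙ)` (stated via convolutions of the pmfs;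
the pmf of `aᵢXᵢ` is `k ↦ fᵢ(aᵢ⁻¹ k)`). -/
theorem renyi_dilated_conv_ge [Fact p.Prime] [NeZero p] {n : ℕ}
    (f : Fin n → ZMod p → ℝ) (hf : ∀ i, IsPMF (f i))
    (hreg : ∀ i, TriangleRegular (f i) ∨ SquareRegular (f i))
    (hself : ∀ i, IsPlusRearr (f i) (f i) ∨ IsMinusRearr (f i) (f i))
    (a : Fin n → ZMod p) (ha : ∀ i, a i ≠ 0) (α : ℝ≥0∞) :
    renyi α (convList (List.ofFn fun i => fun k => f i ((a i)⁻¹ * k))) ≥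
      renyi α (convList (List.ofFn f)) := by
  have hg : ∀ i, ∃ σ : Equiv.Perm (ZMod p), (fun k => f i ((a i)⁻¹ * k)) = f i ∘ σ := fun i =>
    ⟨Equiv.mulLeft₀ _ (inv_ne_zero (ha i)), rfl⟩
  rcases (Fact.out : p.Prime).eq_two_or_odd' with rfl | hp
  · have ha1 : ∀ i, a i = 1 := fun i => Fin.eq_one_of_ne_zero (a i) (ha i)
    simp [ha1]
  · refine renyi_le_of_mem_permHull (isPMF_convList_ofFn fun i => ?_) (isPMF_convList_ofFn hf)
      (convList_mem_permHull hp f _ (fun i => isShiftTri_of_regular hp (hreg i) (hself i)) hg).2 α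
    obtain ⟨σ, hσ⟩ := hg i
    rw [hσ]
    exact (hf i).comp σ

end Paper
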